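/- Let a, b, c be positive real numbers, let {w_n} be the bi-periodic Horadam sequence with initial values w_0, w_1, and let {v_n} be the bi-periodic Lucas sequence. Then for all integers n, m, r, d > 0, w_{2(m+r)n+d} = Σ_{i+j+s=n} (n!/(i!·j!·s!)) · (−1)^j · (−c)^{s(m+r)+mj} · v_m^i · v_r^j · w_{(m+2r)i+rj+d} · (a/b)^{ξ(m)·(i+ξ(i))/2 + ξ(r)·(j+ξ(j))/2 − ξ(mi)·ξ(rj) − ξ(mi+rj)·ξ(d)}, where the sum runs over all triples (i, j, s) of nonnegative integers with i + j + s = n and each exponent of (a/b) is a nonnegative integer. -/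

import Mathlib

/-- The bi-periodic Horadam sequence with parameters `a, b, c` and
initial values `w0, w1`; the bi-periodic Lucas sequence is the
special case with initial values `2, b`. -/
def biper (a b c w0 w1 : ℝ) : ℕ → ℝ
  | 0 => w0
  | 1 => w1
  | n + 2 => (if Even (n + 2) then a else b) * biper a b c w0 w1 (n + 1)
      + c * biper a b c w0 w1 n

/-- The parity function ξ. -/
def xi (n : ℕ) : ℕ := n % 2

/-- The integer exponent of `a/b` in equation (9) of the paper:
`ξ(m)·(i+ξ(i))/2 + ξ(r)·(j+ξ(j))/2 − ξ(mi)·ξ(rj) − ξ(mi+rj)·ξ(d)`. -/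
def expE (m r d i j : ℕ) : ℤ :=
  (xi m : ℤ) * ((i + xi i) / 2) + (xi r : ℤ) * ((j + xi j) / 2)
    - (xi (m * i) : ℤ) * (xi (r * j)) - (xi (m * i + r * j) : ℤ) * (xi d)

/-- The trinomial theorem, indexed by two of the three exponents. -/
theorem trinomial_pow {K : Type*} [Field K] [CharZero K] (x y z : K) (n : ℕ) :
    (x + y + z) ^ n = ∑ i ∈ Finset.range (n + 1), ∑ j ∈ Finset.range (n + 1 - i),
      (n.factorial : K) / ((i.factorial * j.factorial * (n - i - j).factorial : ℕ) : K)
        * (x ^ i * y ^ j * z ^ (n - i - j)) := by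
  rw [add_assoc, add_pow]
  refine Finset.sum_congr rfl fun i hi => ?_
  have hi' : i ≤ n := Finset.mem_range_succ_iff.mp hi
  rw [add_pow, Finset.mul_sum, Finset.sum_mul, Nat.sub_add_comm hi']
  refine Finset.sum_congr rfl fun j hj => ?_
  have hj' : j ≤ n - i := Finset.mem_range_succ_iff.mp hj
  rw [Nat.cast_choose K hi', Nat.cast_choose K hj']
  have h (k : ℕ) : (k.factorial : K) ≠ 0 := Nat.cast_ne_zero.mpr k.factorial_ne_zero
  have h1 := h i
  have h2 := h j
  have h3 := h (n - i)
  have h4 := h (n - i - j)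
  push_cast
  field_simp

theorem xi_eq_zero_or_one (n : ℕ) : xi n = 0 ∨ xi n = 1 :=
  Nat.mod_two_eq_zero_or_one n

/-- Rescaling the odd-indexed terms by `κ` turns the bi-periodic recurrence into one with
constant coefficients, whose solutions have a Binet form. -/
theorem biper_binet {a b c w0 w1 κ α β A B : ℝ} (ha : a = κ * (α + β)) (hb : κ * b = α + β)
    (hc : c = -(α * β)) (h0 : w0 = A + B) (h1 : κ * w1 = A * α + B * β) (n : ℕ) :
    κ ^ xi n * biper a b c w0 w1 n = A * α ^ n + B * β ^ n := by
  induction n using Nat.twoStepInduction with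
  | zero => simp [xi, biper, h0]
  | one => simp [xi, biper, h1]
  | more n ih0 ih1 =>
    rcases Nat.even_or_odd n with hn | hn
    · have e0 : xi n = 0 := Nat.even_iff.mp hn
      have e1 : xi (n + 1) = 1 := Nat.odd_iff.mp hn.add_one
      have e2 : Even (n + 2) := hn.add even_two
      have e3 : xi (n + 2) = 0 := Nat.even_iff.mp e2
      rw [e0] at ih0
      rw [e1] at ih1
      rw [e3, biper, if_pos e2]
      linear_combination biper a b c w0 w1 (n + 1) * ha + (α + β) * ih1 + c * ih0
        + (A * α ^ n + B * β ^ n) * hc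
    · have e0 : xi n = 1 := Nat.odd_iff.mp hn
      have e1 : xi (n + 1) = 0 := Nat.even_iff.mp hn.add_one
      have e2 : Odd (n + 2) := hn.add_even even_two
      have e3 : xi (n + 2) = 1 := Nat.odd_iff.mp e2
      rw [e0] at ih0
      rw [e1] at ih1
      rw [e3, biper, if_neg (Nat.not_even_iff_odd.mpr e2)]
      linear_combination biper a b c w0 w1 (n + 1) * hb + (α + β) * ih1 + c * ih0
        + (A * α ^ n + B * β ^ n) * hc

/-- Doubling `expE` clears its halves and collects its parity corrections. -/
theorem two_mul_expE (m r d i j : ℕ) :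
    (xi d : ℤ) + 2 * expE m r d i j
      = ((xi m * i + xi r * j + xi ((m + 2 * r) * i + r * j + d) : ℕ) : ℤ) := by
  have hmi : xi (m * i) = xi m * xi i := by
    rcases Nat.mod_two_eq_zero_or_one m with h | h <;>
      rcases Nat.mod_two_eq_zero_or_one i with h' | h' <;> simp [xi, Nat.mul_mod, h, h']
  have hrj : xi (r * j) = xi r * xi j := by
    rcases Nat.mod_two_eq_zero_or_one r with h | h <;>
      rcases Nat.mod_two_eq_zero_or_one j with h' | h' <;> simp [xi, Nat.mul_mod, h, h']
  have he : xi ((m + 2 * r) * i + r * j + d) = (xi (m * i) + xi (r * j) + xi d) % 2 := by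
    rw [show (m + 2 * r) * i + r * j + d = m * i + r * j + d + 2 * (r * i) by ring]
    simp only [xi]
    omega
  have hs : xi (m * i + r * j) = (xi (m * i) + xi (r * j)) % 2 := by
    simp only [xi]
    omega
  have hi : (i + xi i : ℤ) % 2 = 0 := by
    simp only [xi]
    omega
  have hj : (j + xi j : ℤ) % 2 = 0 := by
    simp only [xi]
    omega
  rw [expE, he, hs, hmi, hrj]
  rcases xi_eq_zero_or_one m with h1 | h1 <;> rcases xi_eq_zero_or_one r with h2 | h2 <;>
    rcases xi_eq_zero_or_one d with h3 | h3 <;> rcases xi_eq_zero_or_one i with h4 | h4 <;>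
    rcases xi_eq_zero_or_one j with h5 | h5 <;> simp only [h1, h2, h3, h4, h5] at hi hj ⊢ <;>
    push_cast at hi hj ⊢ <;> norm_num at hi hj ⊢ <;> omega

theorem expE_nonneg (m r d i j : ℕ) : 0 ≤ expE m r d i j := by
  have h := two_mul_expE m r d i j
  have hd : xi d ≤ 1 := by
    rcases xi_eq_zero_or_one d with h | h <;> omega
  omega

/-- The roots of `x² = p x + c` satisfy a trinomial relation with Lucas-type coefficients. -/
theorem root_pow_eq (α β : ℝ) (m r : ℕ) :
    α ^ (2 * (m + r)) = (α ^ m + β ^ m) * α ^ (m + 2 * r)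
      + -((α * β) ^ m * ((α ^ r + β ^ r) * α ^ r)) + (α * β) ^ (m + r) := by
  simp only [pow_add, mul_pow, pow_mul', mul_add]
  ring

theorem pow_mul_add_eq_sum (α β : ℝ) (m r n d : ℕ) :
    α ^ (2 * (m + r) * n + d) = ∑ i ∈ Finset.range (n + 1), ∑ j ∈ Finset.range (n + 1 - i),
      (n.factorial : ℝ) / ((i.factorial * j.factorial * (n - i - j).factorial : ℕ) : ℝ)
        * (-1 : ℝ) ^ j * (α * β) ^ ((n - i - j) * (m + r) + m * j)
        * (α ^ m + β ^ m) ^ i * (α ^ r + β ^ r) ^ j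
        * α ^ ((m + 2 * r) * i + r * j + d) := by
  rw [pow_add, pow_mul, root_pow_eq α β m r, trinomial_pow, Finset.sum_mul]
  refine Finset.sum_congr rfl fun i _ => ?_
  rw [Finset.sum_mul]
  refine Finset.sum_congr rfl fun j _ => ?_
  rw [neg_pow, pow_add (α * β), pow_add α _ d, pow_add α _ (r * j), mul_comm (n - i - j) (m + r)]
  simp only [mul_pow (α ^ m + β ^ m), mul_pow ((α * β) ^ m), mul_pow (α ^ r + β ^ r), pow_mul]
  ring

theorem stmt16 (a b c w0 w1 : ℝ) (ha : 0 < a) (hb : 0 < b) (hc : 0 < c)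
    (n m r d : ℕ) (hn : 0 < n) (hm : 0 < m) (hr : 0 < r) (hd : 0 < d) :
    (∀ i j, i + j ≤ n → 0 ≤ expE m r d i j) ∧
    biper a b c w0 w1 (2 * (m + r) * n + d) =
      ∑ i ∈ Finset.range (n + 1), ∑ j ∈ Finset.range (n + 1 - i),
        (n.factorial : ℝ)
            / ((i.factorial * j.factorial * (n - i - j).factorial : ℕ) : ℝ)
          * (-1 : ℝ) ^ j
          * (-c) ^ ((n - i - j) * (m + r) + m * j)
          * (biper a b c 2 b m) ^ i * (biper a b c 2 b r) ^ j
          * biper a b c w0 w1 ((m + 2 * r) * i + r * j + d)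
          * (a / b) ^ (expE m r d i j) := by
  refine ⟨fun i j _ => expE_nonneg m r d i j, ?_⟩
  obtain ⟨κ, hκ, hκab⟩ : ∃ κ : ℝ, 0 < κ ∧ κ ^ 2 = a / b :=
    ⟨√(a / b), Real.sqrt_pos.mpr (div_pos ha hb), Real.sq_sqrt (div_pos ha hb).le⟩
  obtain ⟨δ, hδ, hδ2⟩ : ∃ δ : ℝ, 0 < δ ∧ δ ^ 2 = (κ * b) ^ 2 + 4 * c :=
    ⟨√((κ * b) ^ 2 + 4 * c), Real.sqrt_pos.mpr (by positivity), Real.sq_sqrt (by positivity)⟩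
  obtain ⟨α, hα⟩ : ∃ α, α = (κ * b + δ) / 2 := ⟨_, rfl⟩
  obtain ⟨β, hβ⟩ : ∃ β, β = (κ * b - δ) / 2 := ⟨_, rfl⟩
  have hsum : κ * b = α + β := by rw [hα, hβ]; ring
  have hprod : -c = α * β := by
    rw [hα, hβ]
    linear_combination hδ2 / 4
  have ha' : a = κ * (α + β) := by
    rw [← hsum, ← mul_assoc, ← sq, hκab, div_mul_cancel₀ _ hb.ne']
  have hc' : c = -(α * β) := by rw [← hprod, neg_neg]
  have hdiff : α - β ≠ 0 := by
    rw [hα, hβ]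
    ring_nf
    exact hδ.ne'
  obtain ⟨A, B, h0, h1⟩ : ∃ A B : ℝ, w0 = A + B ∧ κ * w1 = A * α + B * β := by
    refine ⟨(κ * w1 - β * w0) / (α - β), (α * w0 - κ * w1) / (α - β), ?_, ?_⟩ <;>
      field_simp <;> ring
  have hw := biper_binet ha' hsum hc' h0 h1
  have hv (k : ℕ) : κ ^ xi k * biper a b c 2 b k = α ^ k + β ^ k := by
    simpa using biper_binet ha' hsum hc' (A := 1) (B := 1) (by norm_num) (by simpa using hsum) k
  have hN : xi (2 * (m + r) * n + d) = xi d := by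
    rw [xi, xi, mul_assoc, Nat.mul_add_mod]
  apply mul_left_cancel₀ (pow_ne_zero (xi d) hκ.ne')
  rw [← hN, hw, hN, pow_mul_add_eq_sum α β, pow_mul_add_eq_sum β α, Finset.mul_sum,
    Finset.mul_sum, Finset.mul_sum, ← Finset.sum_add_distrib]
  refine Finset.sum_congr rfl fun i _ => ?_
  rw [Finset.mul_sum, Finset.mul_sum, Finset.mul_sum, ← Finset.sum_add_distrib]
  refine Finset.sum_congr rfl fun j _ => ?_
  have hκE : κ ^ xi d * (a / b) ^ expE m r d i j
      = (κ ^ xi m) ^ i * (κ ^ xi r) ^ j * κ ^ xi ((m + 2 * r) * i + r * j + d) := by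
    rw [← hκab, ← zpow_natCast κ 2, ← zpow_mul, ← zpow_natCast κ (xi d), ← zpow_add₀ hκ.ne',
      Nat.cast_ofNat, two_mul_expE, zpow_natCast, pow_add, pow_add, pow_mul, pow_mul]
  rw [mul_comm β α, add_comm (β ^ m), add_comm (β ^ r), ← hv m, ← hv r, ← hprod]
  simp only [mul_pow (κ ^ _)]
  generalize (n.factorial : ℝ) / _ = C
  generalize (-c) ^ _ = D
  linear_combination
    -(C * (-1) ^ j * D * biper a b c 2 b m ^ i * biper a b c 2 b r ^ j
      * biper a b c w0 w1 ((m + 2 * r) * i + r * j + d)) * hκE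
    - (C * (-1) ^ j * D * (κ ^ xi m) ^ i * biper a b c 2 b m ^ i * (κ ^ xi r) ^ j
      * biper a b c 2 b r ^ j) * hw ((m + 2 * r) * i + r * j + d)
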